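/- arXiv:1808.10415 — 7 statements merged into one kernel-verified Lean document; each statement's English description precedes it below -/
import Mathlib

section
/- Let f : ℝ → ℝ be continuous and strictly positive, let β, β' > 0 be such that f^β and f^{β'} are integrable, and write Z_β = ∫ f(x)^β dx and F_β(x) = Z_β^{-1} ∫_{-∞}^x f(t)^β dt. Suppose g : ℝ → ℝ is differentiable and satisfies F_{β'}(g(x)) = F_β(x) for all x ∈ ℝ. Then for all x ∈ ℝ, f(g(x))^{β'} · g'(x) / Z_{β'} = f(x)^β / Z_β. Consequently, if in addition g̃ : ℝ → ℝ is differentiable and satisfies F_β(g̃(y)) = F_{β'}(y) for all y, then for all x, y ∈ ℝ the acceptance ratio satisfies f(g(x))^{β'} · f(g̃(y))^β · g'(x) · g̃'(y) / (f(x)^β · f(y)^{β'}) = 1. -/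
open MeasureTheory

theorem hasDerivAt_integral_Iic {p : ℝ → ℝ} (hp : Continuous p) (hi : Integrable p) (x : ℝ) :
    HasDerivAt (fun u => ∫ t in Set.Iic u, p t) (p x) x := by
  have h : (fun u => ∫ t in Set.Iic u, p t)
      = fun u => (∫ t in Set.Iic 0, p t) + ∫ t in (0 : ℝ)..u, p t := by
    funext u
    have := intervalIntegral.integral_Iic_sub_Iic (μ := volume) (a := 0) (b := u)
      hi.integrableOn hi.integrableOn
    linarith
  rw [h]
  exact (intervalIntegral.integral_hasDerivAt_right (hp.intervalIntegrable _ _)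
    (hp.stronglyMeasurableAtFilter _ _) hp.continuousAt).const_add _

theorem integral_pos_of_forall_pos {p : ℝ → ℝ} (hpos : ∀ x, 0 < p x) (hi : Integrable p) :
    0 < ∫ t, p t := by
  rw [integral_pos_iff_support_of_nonneg (fun x => (hpos x).le) hi,
    Set.eq_univ_of_forall (s := Function.support p) fun x => (hpos x).ne']
  simp

/-- Change of density under a map that carries one normalized CDF to another. -/
theorem density_eq_of_cdf_eq {p q g : ℝ → ℝ} (hp : Continuous p) (hq : Continuous q)
    (hpi : Integrable p) (hqi : Integrable q) (hg : Differentiable ℝ g)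
    (hF : ∀ x, (∫ t in Set.Iic (g x), q t) / (∫ t, q t)
      = (∫ t in Set.Iic x, p t) / (∫ t, p t)) (x : ℝ) :
    q (g x) * deriv g x / (∫ t, q t) = p x / (∫ t, p t) := by
  have hl := ((hasDerivAt_integral_Iic hq hqi (g x)).comp x (hg x).hasDerivAt).div_const
    (∫ t, q t)
  have hr := (hasDerivAt_integral_Iic hp hpi x).div_const (∫ t, p t)
  exact hl.unique (hr.congr_of_eventuallyEq (Filter.Eventually.of_forall hF))

/-- A CDF-preserving map between tempered distributions makes the QuanTA
swap acceptance ratio identically equal to one. -/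
theorem cdf_preserving_swap_ratio_one
    (f : ℝ → ℝ) (hf_cont : Continuous f) (hf_pos : ∀ x, 0 < f x)
    (β β' : ℝ) (hβ : 0 < β) (hβ' : 0 < β')
    (hint : Integrable (fun x => f x ^ β)) (hint' : Integrable (fun x => f x ^ β'))
    (g : ℝ → ℝ) (hg : Differentiable ℝ g)
    (hF : ∀ x, (∫ t in Set.Iic (g x), f t ^ β') / (∫ t, f t ^ β')
            = (∫ t in Set.Iic x, f t ^ β) / (∫ t, f t ^ β)) :
    (∀ x, f (g x) ^ β' * deriv g x / (∫ t, f t ^ β') = f x ^ β / (∫ t, f t ^ β)) ∧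
    (∀ g2 : ℝ → ℝ, Differentiable ℝ g2 →
      (∀ y, (∫ t in Set.Iic (g2 y), f t ^ β) / (∫ t, f t ^ β)
          = (∫ t in Set.Iic y, f t ^ β') / (∫ t, f t ^ β')) →
      ∀ x y, f (g x) ^ β' * f (g2 y) ^ β * deriv g x * deriv g2 y
          / (f x ^ β * f y ^ β') = 1) := by
  have hc (b : ℝ) : Continuous fun x => f x ^ b :=
    hf_cont.rpow_const fun x => Or.inl (hf_pos x).ne'
  have hpos (b : ℝ) (x : ℝ) : 0 < f x ^ b := Real.rpow_pos_of_pos (hf_pos x) b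
  have hZ := integral_pos_of_forall_pos (hpos β) hint
  have hZ' := integral_pos_of_forall_pos (hpos β') hint'
  have hg_density := density_eq_of_cdf_eq (hc β) (hc β') hint hint' hg hF
  refine ⟨hg_density, fun g2 hg2 hF2 x y => ?_⟩
  have h1 := hg_density x
  have h2 := density_eq_of_cdf_eq (hc β') (hc β) hint' hint hg2 hF2 y
  have hx := hpos β x
  have hy := hpos β' y
  rw [div_eq_div_iff hZ'.ne' hZ.ne'] at h1
  rw [div_eq_div_iff hZ.ne' hZ'.ne'] at h2
  rw [div_eq_one_iff_eq (mul_pos hx hy).ne']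
  refine mul_right_cancel₀ (mul_pos hZ hZ').ne' ?_
  linear_combination f (g2 y) ^ β * deriv g2 y * (∫ t, f t ^ β') * h1
    + f x ^ β * (∫ t, f t ^ β') * h2
end

section
/- Let f : ℝ → ℝ be strictly positive and twice continuously differentiable, let μ ∈ ℝ and β > 0. Assume f^β is integrable, that the functions x ↦ (x−μ)² ((log f)'(x))² f(x)^β, x ↦ (x−μ)² (log f)''(x) f(x)^β and x ↦ (x−μ)(log f)'(x) f(x)^β are integrable, and that (x−μ)² (log f)'(x) f(x)^β → 0 as x → ±∞. Then E_β[k(X)²] = −(1/β) E_β[r(X)] − (2/β) E_β[k(X)]. -/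
open MeasureTheory Filter

/-- `h = log f`. -/
noncomputable def hlog (f : ℝ → ℝ) : ℝ → ℝ := fun x => Real.log (f x)

/-- `k(x) = (x−μ) h'(x)`. -/
noncomputable def kfun (f : ℝ → ℝ) (μ : ℝ) : ℝ → ℝ := fun x => (x - μ) * deriv (hlog f) x

/-- `r(x) = (x−μ)² h''(x)`. -/
noncomputable def rfun (f : ℝ → ℝ) (μ : ℝ) : ℝ → ℝ :=
  fun x => (x - μ) ^ 2 * deriv (deriv (hlog f)) x

/-- Tempered expectation `E_β[φ] = Z_β⁻¹ ∫ φ(x) f(x)^β dx`. -/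
noncomputable def Eb (f : ℝ → ℝ) (β : ℝ) (φ : ℝ → ℝ) : ℝ :=
  (∫ x, φ x * f x ^ β) / (∫ x, f x ^ β)

theorem contDiff_hlog {f : ℝ → ℝ} (hf_pos : ∀ x, 0 < f x) (hf : ContDiff ℝ 2 f) :
    ContDiff ℝ 2 (hlog f) :=
  hf.log fun x => (hf_pos x).ne'

theorem hasDerivAt_rpow_of_hlog {f : ℝ → ℝ} (hf_pos : ∀ x, 0 < f x) (hf : ContDiff ℝ 2 f)
    (β x : ℝ) :
    HasDerivAt (fun y => f y ^ β) (β * deriv (hlog f) x * f x ^ β) x := by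
  have hexp : ∀ y, f y ^ β = Real.exp (hlog f y * β) := fun y =>
    Real.rpow_def_of_pos (hf_pos y) β
  simp only [hexp]
  have hd : HasDerivAt (hlog f) (deriv (hlog f) x) x :=
    ((contDiff_hlog hf_pos hf).differentiable (by norm_num) x).hasDerivAt
  convert (hd.mul_const β).exp using 1
  ring

theorem hasDerivAt_sq_mul_deriv_hlog_mul_rpow {f : ℝ → ℝ} (hf_pos : ∀ x, 0 < f x)
    (hf : ContDiff ℝ 2 f) (μ β x : ℝ) :
    HasDerivAt (fun y => (y - μ) ^ 2 * deriv (hlog f) y * f y ^ β)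
      (2 * ((x - μ) * deriv (hlog f) x * f x ^ β)
        + (x - μ) ^ 2 * deriv (deriv (hlog f)) x * f x ^ β
        + β * ((x - μ) ^ 2 * (deriv (hlog f) x) ^ 2 * f x ^ β)) x := by
  have hd : HasDerivAt (deriv (hlog f)) (deriv (deriv (hlog f)) x) x :=
    ((contDiff_hlog hf_pos hf).differentiable_deriv_two x).hasDerivAt
  refine HasDerivAt.congr_deriv ((((hasDerivAt_id x).sub_const μ).pow 2).mul hd |>.mul
    (hasDerivAt_rpow_of_hlog hf_pos hf β x)) ?_
  simp only [id, Pi.mul_apply, Pi.pow_apply]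
  push_cast
  ring

/-- `E_β[k(X)²] = −(1/β) E_β[r(X)] − (2/β) E_β[k(X)]`. -/
theorem tempered_k_squared_identity
    (f : ℝ → ℝ) (hf_pos : ∀ x, 0 < f x) (hf : ContDiff ℝ 2 f)
    (μ β : ℝ) (hβ : 0 < β)
    (h1 : Integrable (fun x => f x ^ β))
    (h2 : Integrable (fun x => (x - μ) ^ 2 * (deriv (hlog f) x) ^ 2 * f x ^ β))
    (h3 : Integrable (fun x => (x - μ) ^ 2 * deriv (deriv (hlog f)) x * f x ^ β))
    (h4 : Integrable (fun x => (x - μ) * deriv (hlog f) x * f x ^ β))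
    (htop : Tendsto (fun x => (x - μ) ^ 2 * deriv (hlog f) x * f x ^ β) atTop (nhds 0))
    (hbot : Tendsto (fun x => (x - μ) ^ 2 * deriv (hlog f) x * f x ^ β) atBot (nhds 0)) :
    Eb f β (fun x => kfun f μ x ^ 2)
      = -(1 / β) * Eb f β (rfun f μ) - (2 / β) * Eb f β (kfun f μ) := by
  have hsum : Integrable (fun x => 2 * ((x - μ) * deriv (hlog f) x * f x ^ β)
      + (x - μ) ^ 2 * deriv (deriv (hlog f)) x * f x ^ β) := (h4.const_mul 2).add h3
  have hzero := integral_of_hasDerivAt_of_tendsto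
    (hasDerivAt_sq_mul_deriv_hlog_mul_rpow hf_pos hf μ β)
    (hsum.add (h2.const_mul β)) hbot htop
  rw [integral_add hsum (h2.const_mul β), integral_add (h4.const_mul 2) h3,
    integral_const_mul, integral_const_mul] at hzero
  simp only [Eb, kfun, rfun, mul_pow]
  have hsq : (∫ x, (x - μ) ^ 2 * (deriv (hlog f) x) ^ 2 * f x ^ β)
      = -(1 / β) * (∫ x, (x - μ) ^ 2 * deriv (deriv (hlog f)) x * f x ^ β)
        - (2 / β) * ∫ x, (x - μ) * deriv (hlog f) x * f x ^ β := by
    field_simp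
    linarith
  rw [hsq]
  ring
end

section
/- Let f : ℝ → ℝ be strictly positive and twice continuously differentiable, let μ ∈ ℝ and β > 0. Assume f^β is integrable, that x ↦ (x−μ) f'(x) f(x)^{β−1}, x ↦ (x−μ)² ((log f)'(x))² f(x)^β and x ↦ (x−μ)² (log f)''(x) f(x)^β are integrable, and that both (x−μ) f(x)^β → 0 and (x−μ)² (log f)'(x) f(x)^β → 0 as x → ±∞. Then (1/(4β)) E_β[r(X) − k(X)] = −(1/4) Var_β[k(X)] + 1/(2β²). -/
open MeasureTheory Filter

/-- Tempered variance `Var_β[φ] = E_β[φ²] − (E_β[φ])²`. -/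
noncomputable def Varb (f : ℝ → ℝ) (β : ℝ) (φ : ℝ → ℝ) : ℝ :=
  Eb f β (fun x => φ x ^ 2) - (Eb f β φ) ^ 2

lemma hasDerivAt_hlog {f : ℝ → ℝ} {x : ℝ} (hx : f x ≠ 0) (hf : DifferentiableAt ℝ f x) :
    HasDerivAt (hlog f) (deriv f x / f x) x :=
  hf.hasDerivAt.log hx

lemma differentiableAt_deriv_hlog {f : ℝ → ℝ} (hf_pos : ∀ x, 0 < f x) (hf : ContDiff ℝ 2 f)
    (x : ℝ) : DifferentiableAt ℝ (deriv (hlog f)) x := by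
  have hlog2 : ContDiff ℝ 2 (hlog f) := hf.log fun x => (hf_pos x).ne'
  exact hlog2.differentiable_deriv_two x

lemma hasDerivAt_rpow_eq_deriv_hlog {f : ℝ → ℝ} {x : ℝ} (hx : 0 < f x)
    (hf : DifferentiableAt ℝ f x) (β : ℝ) :
    HasDerivAt (fun y => f y ^ β) (β * deriv (hlog f) x * f x ^ β) x := by
  convert hf.hasDerivAt.rpow_const (p := β) (Or.inl hx.ne') using 1
  rw [(hasDerivAt_hlog hx.ne' hf).deriv, Real.rpow_sub_one hx.ne']
  ring

/-- `(1/(4β)) E_β[r − k] = −(1/4) Var_β[k] + 1/(2β²)`. -/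
theorem tempered_R_identity
    (f : ℝ → ℝ) (hf_pos : ∀ x, 0 < f x) (hf : ContDiff ℝ 2 f)
    (μ β : ℝ) (hβ : 0 < β)
    (h1 : Integrable (fun x => f x ^ β))
    (h2 : Integrable (fun x => (x - μ) * deriv f x * f x ^ (β - 1)))
    (h3 : Integrable (fun x => (x - μ) ^ 2 * (deriv (hlog f) x) ^ 2 * f x ^ β))
    (h4 : Integrable (fun x => (x - μ) ^ 2 * deriv (deriv (hlog f)) x * f x ^ β))
    (htop1 : Tendsto (fun x => (x - μ) * f x ^ β) atTop (nhds 0))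
    (hbot1 : Tendsto (fun x => (x - μ) * f x ^ β) atBot (nhds 0))
    (htop2 : Tendsto (fun x => (x - μ) ^ 2 * deriv (hlog f) x * f x ^ β) atTop (nhds 0))
    (hbot2 : Tendsto (fun x => (x - μ) ^ 2 * deriv (hlog f) x * f x ^ β) atBot (nhds 0)) :
    (1 / (4 * β)) * Eb f β (fun x => rfun f μ x - kfun f μ x)
      = -(1 / 4) * Varb f β (kfun f μ) + 1 / (2 * β ^ 2) := by
  have hd : Differentiable ℝ f := hf.differentiable (by norm_num)
  have hw x := hasDerivAt_rpow_eq_deriv_hlog (hf_pos x) (hd x) β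
  have hsub (x : ℝ) : HasDerivAt (fun y : ℝ => y - μ) 1 x := (hasDerivAt_id x).sub_const μ
  have hZ : 0 < ∫ x, f x ^ β :=
    integral_pos_of_integrable_nonneg_nonzero (x := 0)
      (hd.continuous.rpow_const fun x => Or.inl (hf_pos x).ne') h1
      (fun x => (Real.rpow_pos_of_pos (hf_pos x) β).le) (Real.rpow_pos_of_pos (hf_pos 0) β).ne'
  have hk : Integrable (fun x => kfun f μ x * f x ^ β) := by
    refine h2.congr (.of_forall fun x => ?_)
    simp only [kfun, (hasDerivAt_hlog (hf_pos x).ne' (hd x)).deriv,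
      Real.rpow_sub_one (hf_pos x).ne']
    ring
  have hk2 : Integrable (fun x => kfun f μ x ^ 2 * f x ^ β) := by
    simpa only [kfun, mul_pow] using h3
  have hr : Integrable (fun x => rfun f μ x * f x ^ β) := h4
  have first_moment : (∫ x, f x ^ β) + β * ∫ x, kfun f μ x * f x ^ β = 0 := by
    rw [← integral_const_mul, ← integral_add h1 (hk.const_mul β)]
    refine (integral_of_hasDerivAt_of_tendsto (fun x => ?_) (h1.add (hk.const_mul β))
      hbot1 htop1).trans (sub_zero 0)
    refine ((hsub x).mul (hw x)).congr_deriv ?_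
    simp only [kfun, Pi.add_apply]
    ring
  have second_moment : 2 * (∫ x, kfun f μ x * f x ^ β) + (∫ x, rfun f μ x * f x ^ β)
      + β * ∫ x, kfun f μ x ^ 2 * f x ^ β = 0 := by
    have hkr : Integrable (fun x => 2 * (kfun f μ x * f x ^ β) + rfun f μ x * f x ^ β) :=
      (hk.const_mul 2).add hr
    rw [← integral_const_mul, ← integral_const_mul, ← integral_add (hk.const_mul 2) hr,
      ← integral_add hkr (hk2.const_mul β)]
    refine (integral_of_hasDerivAt_of_tendsto (fun x => ?_) (hkr.add (hk2.const_mul β))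
      hbot2 htop2).trans (sub_zero 0)
    refine ((((hsub x).pow 2).mul
      (differentiableAt_deriv_hlog hf_pos hf x).hasDerivAt).mul (hw x)).congr_deriv ?_
    simp only [kfun, rfun, Pi.add_apply, Pi.mul_apply, Pi.pow_apply]
    ring
  have hrk : ∫ x, (rfun f μ x - kfun f μ x) * f x ^ β
      = (∫ x, rfun f μ x * f x ^ β) - ∫ x, kfun f μ x * f x ^ β := by
    simp only [sub_mul]
    exact integral_sub hr hk
  simp only [Varb, Eb, hrk]
  generalize (∫ x, f x ^ β) = Z at *
  generalize (∫ x, kfun f μ x * f x ^ β) = K at *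
  generalize (∫ x, rfun f μ x * f x ^ β) = R at *
  generalize (∫ x, kfun f μ x ^ 2 * f x ^ β) = Q at *
  obtain rfl : Z = -(β * K) := by linarith
  obtain rfl : R = -(2 * K) - β * Q := by linarith
  have hK : K ≠ 0 := by rintro rfl; simp at hZ
  field_simp
  ring
end

section
/- Let σ > 0 and let G be a real random variable distributed as the Gaussian N(−σ²/2, σ²). Then E[min(1, e^G)] = 2Φ(−σ/2), where Φ denotes the standard normal cumulative distribution function, i.e. ∫ min(1, exp g) dν(g) = 2Φ(−σ/2) with ν the Gaussian measure on ℝ with mean −σ²/2 and variance σ². -/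
open MeasureTheory ProbabilityTheory

/-- The standard normal cumulative distribution function
`Φ(t) = ∫_{-∞}^t (2π)^{-1/2} exp(−x²/2) dx`. -/
noncomputable def stdNormCDF (t : ℝ) : ℝ :=
  ∫ x in Set.Iic t, (Real.sqrt (2 * Real.pi))⁻¹ * Real.exp (-x ^ 2 / 2)

theorem measureReal_gaussianReal_eq_setIntegral (m : ℝ) {v : NNReal} (hv : v ≠ 0) (s : Set ℝ) :
    (gaussianReal m v).real s = ∫ x in s, gaussianPDFReal m v x := by
  rw [measureReal_def, gaussianReal_apply_eq_integral m hv, ENNReal.toReal_ofReal]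
  exact integral_nonneg fun x => gaussianPDFReal_nonneg m v x

theorem stdNormCDF_eq_measureReal (t : ℝ) :
    stdNormCDF t = (gaussianReal 0 1).real (Set.Iic t) := by
  rw [measureReal_gaussianReal_eq_setIntegral 0 one_ne_zero]
  simp [stdNormCDF, gaussianPDFReal]

/-- The upper tail of a Gaussian measure in terms of `Φ`. -/
theorem measureReal_gaussianReal_Ioi (m a : ℝ) {σ : ℝ} (hσ : 0 < σ) :
    (gaussianReal m (σ ^ 2).toNNReal).real (Set.Ioi a) = stdNormCDF ((m - a) / σ) := by
  have hmap : gaussianReal m (σ ^ 2).toNNReal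
      = (gaussianReal 0 1).map (fun x => -σ * x + m) := by
    have h : (fun x : ℝ => -σ * x + m) = (fun x => x + m) ∘ (fun x => -σ * x) := rfl
    rw [h, ← Measure.map_map (by fun_prop) (by fun_prop), gaussianReal_map_const_mul,
      gaussianReal_map_add_const]
    congr 1
    · simp
    · ext
      simp [sq_nonneg]
  have hpre : (fun x => -σ * x + m) ⁻¹' Set.Ioi a = Set.Iio ((m - a) / σ) := by
    ext x
    simp only [Set.mem_preimage, Set.mem_Ioi, Set.mem_Iio, lt_div_iff₀ hσ]
    constructor <;> intro h <;> linarith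
  have := nullSingletonClass_gaussianReal (μ := 0) (one_ne_zero (α := NNReal))
  rw [hmap, map_measureReal_apply (by fun_prop) measurableSet_Ioi, hpre,
    stdNormCDF_eq_measureReal]
  exact measureReal_congr Iio_ae_eq_Iic

/-- Tilting `N(−v/2, v)` by `exp` reflects its density. -/
theorem gaussianPDFReal_mul_exp_eq_neg (v : NNReal) (hv : v ≠ 0) (x : ℝ) :
    gaussianPDFReal (-v / 2) v x * Real.exp x = gaussianPDFReal (-v / 2) v (-x) := by
  have hv' : (v : ℝ) ≠ 0 := by exact_mod_cast hv
  simp only [gaussianPDFReal]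
  rw [mul_assoc, ← Real.exp_add]
  congr 2
  field_simp
  ring

theorem integral_min_one_exp_gaussianReal (v : NNReal) (hv : v ≠ 0) :
    ∫ g, min 1 (Real.exp g) ∂(gaussianReal (-v / 2) v)
      = 2 * (gaussianReal (-v / 2) v).real (Set.Ioi 0) := by
  have hlow : Set.EqOn (fun x => gaussianPDFReal (-v / 2) v x • min 1 (Real.exp x))
      (fun x => gaussianPDFReal (-v / 2) v (-x)) (Set.Iic 0) := fun x hx => by
    simp only [smul_eq_mul]
    rw [min_eq_right (Real.exp_le_one_iff.2 hx), gaussianPDFReal_mul_exp_eq_neg v hv]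
  have hhigh : Set.EqOn (fun x => gaussianPDFReal (-v / 2) v x • min 1 (Real.exp x))
      (gaussianPDFReal (-v / 2) v) (Set.Ioi 0) := fun x hx => by
    simp only [smul_eq_mul]
    rw [min_eq_left (Real.one_le_exp (le_of_lt hx)), mul_one]
  have hint := integrable_gaussianPDFReal (-v / 2) v
  rw [integral_gaussianReal_eq_integral_smul hv,
    ← intervalIntegral.integral_Iic_add_Ioi (b := 0)
      (hint.comp_neg.integrableOn.congr_fun hlow.symm measurableSet_Iic)
      (hint.integrableOn.congr_fun hhigh.symm measurableSet_Ioi),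
    setIntegral_congr_fun measurableSet_Iic hlow, setIntegral_congr_fun measurableSet_Ioi hhigh,
    integral_comp_neg_Iic, neg_zero, measureReal_gaussianReal_eq_setIntegral _ hv, two_mul]

/-- If `G ∼ N(−σ²/2, σ²)` then `E[min(1, e^G)] = 2Φ(−σ/2)`. -/
theorem expected_acceptance_gaussian (σ : ℝ) (hσ : 0 < σ) :
    ∫ g, min 1 (Real.exp g) ∂(gaussianReal (-σ ^ 2 / 2) ((σ ^ 2).toNNReal))
      = 2 * stdNormCDF (-σ / 2) := by
  have hv : (σ ^ 2).toNNReal ≠ 0 := (Real.toNNReal_pos.2 (by positivity)).ne'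
  have h := integral_min_one_exp_gaussianReal _ hv
  rw [Real.coe_toNNReal _ (sq_nonneg σ), measureReal_gaussianReal_Ioi _ _ hσ] at h
  rw [h]
  congr 2
  field_simp
  ring
end

section
/- Let Φ be the standard normal cumulative distribution function and let u* ∈ (0,∞) be any maximizer of the function u ↦ u²Φ(−u/√2) over (0,∞). Then the induced acceptance rate satisfies 0.2335 ≤ 2Φ(−u*/√2) ≤ 0.2345, i.e. the optimal acceptance rate is 0.234 to three significant figures. -/
open MeasureTheory

lemma stdNormCDF_neg_eq_integral_Ioi (t : ℝ) :
    stdNormCDF (-t) =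
      (Real.sqrt (2 * Real.pi))⁻¹ * ∫ x in Set.Ioi t, Real.exp (-x ^ 2 / 2) := by
  unfold stdNormCDF
  rw [integral_const_mul]
  congr 1
  have h := integral_comp_neg_Iic (-t) (fun x : ℝ => Real.exp (-x ^ 2 / 2))
  simpa using h

lemma integrable_exp_neg_sq_div_two : Integrable fun x : ℝ => Real.exp (-x ^ 2 / 2) := by
  refine (integrable_exp_neg_mul_sq (b := 1 / 2) (by norm_num)).congr (.of_forall fun x => ?_)
  ring_nf

lemma integral_Ioi_zero_exp_neg_sq_div_two :
    ∫ x in Set.Ioi (0 : ℝ), Real.exp (-x ^ 2 / 2) = Real.sqrt (2 * Real.pi) / 2 := by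
  have h := integral_gaussian_Ioi (1 / 2)
  rw [show Real.pi / (1 / 2) = 2 * Real.pi by ring] at h
  rw [← h]
  congr 1
  ext x
  ring_nf

lemma stdNormCDF_neg_eq_intervalIntegral (t : ℝ) :
    stdNormCDF (-t) = (Real.sqrt (2 * Real.pi))⁻¹ *
      (Real.sqrt (2 * Real.pi) / 2 - ∫ x in (0 : ℝ)..t, Real.exp (-x ^ 2 / 2)) := by
  rw [stdNormCDF_neg_eq_integral_Ioi, ← integral_Ioi_zero_exp_neg_sq_div_two,
    ← intervalIntegral.integral_Ioi_sub_Ioi' integrable_exp_neg_sq_div_two.integrableOn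
      integrable_exp_neg_sq_div_two.integrableOn]
  ring

lemma hasDerivAt_integral_exp_neg_sq_div_two (t : ℝ) :
    HasDerivAt (fun s => ∫ x in (0 : ℝ)..s, Real.exp (-x ^ 2 / 2)) (Real.exp (-t ^ 2 / 2)) t := by
  have hc : Continuous fun x : ℝ => Real.exp (-x ^ 2 / 2) := by fun_prop
  exact hc.integral_hasStrictDerivAt 0 t |>.hasDerivAt

lemma hasDerivAt_exp_neg_sq_div_two (t : ℝ) :
    HasDerivAt (fun s : ℝ => Real.exp (-s ^ 2 / 2)) (-t * Real.exp (-t ^ 2 / 2)) t := by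
  have h : HasDerivAt (fun s : ℝ => -s ^ 2 / 2) (-t) t := by
    refine ((hasDerivAt_pow 2 t).neg.div_const 2).congr_deriv ?_
    norm_num
    ring
  exact h.exp.congr_deriv (mul_comm _ _)

/-- The upper Mills ratio bound for the Gaussian tail. -/
lemma mul_integral_Ioi_exp_neg_sq_div_two_le {t : ℝ} (ht : 0 < t) :
    t * ∫ x in Set.Ioi t, Real.exp (-x ^ 2 / 2) ≤ Real.exp (-t ^ 2 / 2) := by
  have hlim : Filter.Tendsto (fun x : ℝ => -Real.exp (-x ^ 2 / 2)) Filter.atTop (nhds 0) := by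
    rw [← neg_zero]
    refine (Real.tendsto_exp_atBot.comp ?_).neg
    have h := (Filter.tendsto_pow_atTop (α := ℝ) two_ne_zero).atTop_div_const (two_pos)
    refine (Filter.tendsto_neg_atTop_atBot.comp h).congr fun x => ?_
    simp [neg_div]
  have hderiv (x : ℝ) (_ : x ∈ Set.Ici t) :
      HasDerivAt (fun x : ℝ => -Real.exp (-x ^ 2 / 2)) (x * Real.exp (-x ^ 2 / 2)) x := by
    exact (hasDerivAt_exp_neg_sq_div_two x).neg.congr_deriv (by ring)
  have hpos (x : ℝ) (hx : x ∈ Set.Ioi t) : 0 ≤ x * Real.exp (-x ^ 2 / 2) :=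
    mul_nonneg (ht.trans hx).le (Real.exp_pos _).le
  have hint := integrableOn_Ioi_deriv_of_nonneg' hderiv hpos hlim
  have heq := integral_Ioi_of_hasDerivAt_of_nonneg' hderiv hpos hlim
  rw [← integral_const_mul]
  calc _ ≤ ∫ x in Set.Ioi t, x * Real.exp (-x ^ 2 / 2) :=
        setIntegral_mono_on (integrable_exp_neg_sq_div_two.const_mul t).integrableOn hint
          measurableSet_Ioi fun x hx => mul_le_mul_of_nonneg_right hx.le (Real.exp_pos _).le
    _ = _ := by rw [heq]; ring

lemma abs_exp_neg_sq_div_two_sub_le {x : ℝ} (hx : x ^ 2 ≤ 2) :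
    |Real.exp (-x ^ 2 / 2) - (1 - x ^ 2 / 2 + x ^ 4 / 8 - x ^ 6 / 48 + x ^ 8 / 384
      - x ^ 10 / 3840 + x ^ 12 / 46080 - x ^ 14 / 645120)| ≤ 1 / 30000 := by
  have habs : |-x ^ 2 / 2| ≤ 1 := by
    rw [abs_le]
    constructor <;> nlinarith [sq_nonneg x]
  have h := Real.exp_bound habs (n := 8) (by norm_num)
  have hp : |-x ^ 2 / 2| ^ 8 ≤ 1 := pow_le_one₀ (abs_nonneg _) habs
  simp only [Finset.sum_range_succ, Finset.sum_range_zero, Nat.factorial] at h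
  norm_num at h hp
  refine le_trans (le_of_eq ?_) (h.trans ?_)
  · congr 1
    ring
  · linarith

lemma abs_integral_exp_neg_sq_div_two_sub_le {t : ℝ} (ht : 0 ≤ t) (ht2 : t ^ 2 ≤ 2) :
    |(∫ x in (0 : ℝ)..t, Real.exp (-x ^ 2 / 2)) - (t - t ^ 3 / 6 + t ^ 5 / 40 - t ^ 7 / 336
      + t ^ 9 / 3456 - t ^ 11 / 42240 + t ^ 13 / 599040 - t ^ 15 / 9676800)| ≤ t / 30000 := by
  have hpoly : ∫ x in (0 : ℝ)..t, (1 - x ^ 2 / 2 + x ^ 4 / 8 - x ^ 6 / 48 + x ^ 8 / 384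
      - x ^ 10 / 3840 + x ^ 12 / 46080 - x ^ 14 / 645120) =
      t - t ^ 3 / 6 + t ^ 5 / 40 - t ^ 7 / 336
      + t ^ 9 / 3456 - t ^ 11 / 42240 + t ^ 13 / 599040 - t ^ 15 / 9676800 := by
    have hd (x : ℝ) (_ : x ∈ Set.uIcc 0 t) : HasDerivAt
        (fun t : ℝ => t - t ^ 3 / 6 + t ^ 5 / 40 - t ^ 7 / 336
          + t ^ 9 / 3456 - t ^ 11 / 42240 + t ^ 13 / 599040 - t ^ 15 / 9676800)
        (1 - x ^ 2 / 2 + x ^ 4 / 8 - x ^ 6 / 48 + x ^ 8 / 384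
          - x ^ 10 / 3840 + x ^ 12 / 46080 - x ^ 14 / 645120) x := by
      have hm (n : ℕ) (c : ℝ) := (hasDerivAt_pow n x).div_const c
      refine HasDerivAt.congr_deriv ((((((((hasDerivAt_id x).sub (hm 3 6)).add (hm 5 40)).sub (hm 7 336)).add
        (hm 9 3456)).sub (hm 11 42240)).add (hm 13 599040)).sub (hm 15 9676800)) ?_
      norm_num
      ring
    rw [intervalIntegral.integral_eq_sub_of_hasDerivAt hd
      (Continuous.intervalIntegrable (by fun_prop) _ _)]
    simp
  rw [← hpoly, ← intervalIntegral.integral_sub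
    (Continuous.intervalIntegrable (by fun_prop) _ _)
    (Continuous.intervalIntegrable (by fun_prop) _ _)]
  have h := intervalIntegral.norm_integral_le_of_norm_le_const (a := 0) (b := t) (C := 1 / 30000)
    (f := fun x : ℝ => Real.exp (-x ^ 2 / 2) - (1 - x ^ 2 / 2 + x ^ 4 / 8 - x ^ 6 / 48
      + x ^ 8 / 384 - x ^ 10 / 3840 + x ^ 12 / 46080 - x ^ 14 / 645120)) fun x hx => by
      rw [Set.uIoc_of_le ht] at hx
      exact abs_exp_neg_sq_div_two_sub_le (by nlinarith [hx.1, hx.2])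
  rw [Real.norm_eq_abs, sub_zero, abs_of_nonneg ht] at h
  linarith

lemma sqrt_two_mul_pi_bounds :
    2.5066 < Real.sqrt (2 * Real.pi) ∧ Real.sqrt (2 * Real.pi) < 2.5067 := by
  have h1 := Real.pi_gt_d6
  have h2 := Real.pi_lt_d6
  constructor
  · rw [Real.lt_sqrt (by norm_num)]
    norm_num at *
    linarith
  · rw [Real.sqrt_lt' (by norm_num)]
    norm_num at *
    linarith

/-- The stationarity defect `√(2π) (2 Φ(-t) - t φ(t))` is strictly decreasing on `[0, 3/2]`. -/
lemma strictAntiOn_sqrt_two_mul_pi_sub :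
    StrictAntiOn (fun t : ℝ => Real.sqrt (2 * Real.pi)
      - 2 * (∫ x in (0 : ℝ)..t, Real.exp (-x ^ 2 / 2)) - t * Real.exp (-t ^ 2 / 2))
      (Set.Icc 0 (3 / 2)) := by
  have hd (t : ℝ) := (((hasDerivAt_integral_exp_neg_sq_div_two t).const_mul 2).const_sub
    (Real.sqrt (2 * Real.pi))).sub ((hasDerivAt_id t).mul (hasDerivAt_exp_neg_sq_div_two t))
  refine strictAntiOn_of_deriv_neg (convex_Icc _ _)
    (fun t _ => (hd t).continuousAt.continuousWithinAt) fun t ht => ?_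
  rw [interior_Icc] at ht
  refine (hd t).deriv.trans_lt ?_
  have h : t ^ 2 < 3 := by nlinarith [ht.1, ht.2]
  simp only [id]
  nlinarith [Real.exp_pos (-t ^ 2 / 2)]

lemma antitoneOn_mul_exp_neg_sq_div_two :
    AntitoneOn (fun t : ℝ => t * Real.exp (-t ^ 2 / 2)) (Set.Ici 1) := by
  have hd (t : ℝ) := (hasDerivAt_id t).mul (hasDerivAt_exp_neg_sq_div_two t)
  refine antitoneOn_of_deriv_nonpos (convex_Ici _)
    (fun t _ => (hd t).continuousAt.continuousWithinAt)
    (fun t _ => (hd t).differentiableAt.differentiableWithinAt) fun t ht => ?_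
  rw [interior_Ici] at ht
  refine (hd t).deriv.trans_le ?_
  have h : 1 < t ^ 2 := by nlinarith [ht.out]
  simp only [id]
  nlinarith [Real.exp_pos (-t ^ 2 / 2)]

lemma two_mul_stdNormCDF_neg_eq_of_isMax {t : ℝ} (ht : 0 < t)
    (hmax : ∀ s > 0, s ^ 2 * stdNormCDF (-s) ≤ t ^ 2 * stdNormCDF (-t)) :
    2 * stdNormCDF (-t) = (Real.sqrt (2 * Real.pi))⁻¹ * (t * Real.exp (-t ^ 2 / 2)) := by
  have hloc : IsLocalMax (fun s => s ^ 2 * stdNormCDF (-s)) t := by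
    filter_upwards [Ioi_mem_nhds ht] with s hs using hmax s hs
  have hd : HasDerivAt (fun s => stdNormCDF (-s))
      ((Real.sqrt (2 * Real.pi))⁻¹ * -Real.exp (-t ^ 2 / 2)) t := by
    simp_rw [stdNormCDF_neg_eq_intervalIntegral]
    exact ((hasDerivAt_integral_exp_neg_sq_div_two t).const_sub _).const_mul _
  have h := hloc.hasDerivAt_eq_zero ((hasDerivAt_pow 2 t).mul hd)
  apply mul_left_cancel₀ ht.ne'
  norm_num only at h
  linarith

lemma two_mul_stdNormCDF_neg_bounds_of_isMax {t : ℝ} (ht : 0 < t)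
    (hmax : ∀ s > 0, s ^ 2 * stdNormCDF (-s) ≤ t ^ 2 * stdNormCDF (-t)) :
    0.2335 ≤ 2 * stdNormCDF (-t) ∧ 2 * stdNormCDF (-t) ≤ 0.2345 := by
  obtain ⟨hs1, hs2⟩ := sqrt_two_mul_pi_bounds
  have hs : 0 < Real.sqrt (2 * Real.pi) := by linarith
  have hfoc := two_mul_stdNormCDF_neg_eq_of_isMax ht hmax
  have hlt : t < 3 / 2 := by
    by_contra! h
    have hm := mul_integral_Ioi_exp_neg_sq_div_two_le ht
    have he := Real.exp_pos (-t ^ 2 / 2)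
    rw [stdNormCDF_neg_eq_integral_Ioi, mul_left_comm, mul_right_inj' (inv_ne_zero hs.ne')] at hfoc
    have hsq : t * (t * Real.exp (-t ^ 2 / 2)) ≤ 2 * Real.exp (-t ^ 2 / 2) := by
      rw [← hfoc]
      linarith
    have ht2 : 2 < t * t := by nlinarith
    nlinarith
  have hzero : Real.sqrt (2 * Real.pi)
      - 2 * (∫ x in (0 : ℝ)..t, Real.exp (-x ^ 2 / 2)) - t * Real.exp (-t ^ 2 / 2) = 0 := by
    rw [stdNormCDF_neg_eq_intervalIntegral, mul_left_comm,
      mul_right_inj' (inv_ne_zero hs.ne')] at hfoc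
    linarith
  have hea := abs_le.1 (abs_exp_neg_sq_div_two_sub_le (x := 1.187) (by norm_num))
  have heb := abs_le.1 (abs_exp_neg_sq_div_two_sub_le (x := 1.1925) (by norm_num))
  have hia := abs_le.1 (abs_integral_exp_neg_sq_div_two_sub_le (t := 1.187)
    (by norm_num) (by norm_num))
  have hib := abs_le.1 (abs_integral_exp_neg_sq_div_two_sub_le (t := 1.1925)
    (by norm_num) (by norm_num))
  have hta : 1.187 < t := by
    rw [← strictAntiOn_sqrt_two_mul_pi_sub.lt_iff_gt ⟨ht.le, hlt.le⟩
      ⟨by norm_num, by norm_num⟩]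
    simp only [hzero]
    linarith
  have htb : t < 1.1925 := by
    rw [← strictAntiOn_sqrt_two_mul_pi_sub.lt_iff_gt ⟨by norm_num, by norm_num⟩
      ⟨ht.le, hlt.le⟩]
    simp only [hzero]
    linarith
  have h1t : (1 : ℝ) ≤ t := by linarith
  have hle := antitoneOn_mul_exp_neg_sq_div_two (Set.mem_Ici.2 (by norm_num)) h1t hta.le
  have hge := antitoneOn_mul_exp_neg_sq_div_two h1t (Set.mem_Ici.2 (by norm_num)) htb.le
  simp only at hle hge
  rw [hfoc, inv_mul_eq_div, le_div_iff₀ hs, div_le_iff₀ hs]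
  constructor <;> linarith

/-- any maximizer `u*` of `u ↦ u²Φ(−u/√2)` over `(0,∞)` induces an
acceptance rate `2Φ(−u*/√2)` equal to 0.234 to three significant figures. -/
theorem optimal_acceptance_rate_is_0234
    (ustar : ℝ) (hu : ustar ∈ Set.Ioi (0 : ℝ))
    (hmax : ∀ u ∈ Set.Ioi (0 : ℝ),
      u ^ 2 * stdNormCDF (-u / Real.sqrt 2) ≤ ustar ^ 2 * stdNormCDF (-ustar / Real.sqrt 2)) :
    0.2335 ≤ 2 * stdNormCDF (-ustar / Real.sqrt 2) ∧
      2 * stdNormCDF (-ustar / Real.sqrt 2) ≤ 0.2345 := by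
  have h2 : 0 < Real.sqrt 2 := by positivity
  rw [neg_div] at hmax ⊢
  refine two_mul_stdNormCDF_neg_bounds_of_isMax (div_pos hu h2) fun s hs => ?_
  have h := hmax (s * Real.sqrt 2) (mul_pos hs h2)
  rw [neg_div, mul_div_cancel_right₀ _ h2.ne', mul_pow, Real.sq_sqrt zero_le_two] at h
  rw [div_pow, Real.sq_sqrt zero_le_two]
  linarith
end

section
/- Let μ ∈ ℝ, σ > 0 and β > 0, and let f(x) = (2πσ²)^{-1/2} exp(−(x−μ)²/(2σ²)) be the density of N(μ, σ²). Then the variance of log f(X) when X ∼ N(μ, σ²/β) equals 1/(2β²); that is, I(β) := Var_{N(μ,σ²/β)}[log f(X)] = 1/(2β²). Consequently, since V(β) = 1/β² and R(β) := E_{N(μ,σ²/β)}[(X−μ)² (log f)''(X) − (X−μ)(log f)'(X)] = 0, one has (1/2)V(β) − I(β) + R(β)/(4β) = 0 for the Gaussian target. -/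
open MeasureTheory ProbabilityTheory

open scoped NNReal

/-- The fourth moment of a centered real Gaussian measure. -/
lemma integral_pow_four_gaussianReal_zero (v : ℝ≥0) :
    ∫ x, x ^ 4 ∂(gaussianReal 0 v) = 3 * (v : ℝ) ^ 2 := by
  have hmgf : mgf id (gaussianReal 0 v) = fun t ↦ Real.exp (v * t ^ 2 / 2) := by
    simp [mgf_id_gaussianReal]
  have hE (t : ℝ) : HasDerivAt (fun t : ℝ ↦ Real.exp (v * t ^ 2 / 2))
      (v * t * Real.exp (v * t ^ 2 / 2)) t := by
    convert (((hasDerivAt_pow 2 t).const_mul (v : ℝ)).div_const 2).exp using 1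
    push_cast
    ring
  have h1 : deriv (fun t : ℝ ↦ Real.exp (v * t ^ 2 / 2))
      = fun t ↦ v * t * Real.exp (v * t ^ 2 / 2) := funext fun t ↦ (hE t).deriv
  have h2 : deriv (fun t : ℝ ↦ v * t * Real.exp (v * t ^ 2 / 2))
      = fun t ↦ (v + v ^ 2 * t ^ 2) * Real.exp (v * t ^ 2 / 2) := by
    funext t
    refine ((((hasDerivAt_id' t).const_mul (v : ℝ)).mul (hE t)).deriv).trans ?_
    ring
  have h3 : deriv (fun t : ℝ ↦ (v + v ^ 2 * t ^ 2) * Real.exp (v * t ^ 2 / 2))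
      = fun t ↦ (3 * v ^ 2 * t + v ^ 3 * t ^ 3) * Real.exp (v * t ^ 2 / 2) := by
    funext t
    refine (((((hasDerivAt_pow 2 t).const_mul ((v : ℝ) ^ 2)).const_add (v : ℝ)).mul
      (hE t)).deriv).trans ?_
    push_cast
    ring
  have h4 : deriv (fun t : ℝ ↦ (3 * v ^ 2 * t + v ^ 3 * t ^ 3) * Real.exp (v * t ^ 2 / 2)) 0
      = 3 * (v : ℝ) ^ 2 := by
    refine (((((hasDerivAt_id' (0 : ℝ)).const_mul (3 * (v : ℝ) ^ 2)).add
      ((hasDerivAt_pow 3 (0 : ℝ)).const_mul ((v : ℝ) ^ 3))).mul (hE 0)).deriv).trans ?_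
    simp
  have h := iteratedDeriv_mgf_zero (X := id) (μ := gaussianReal 0 v) (by simp) 4
  rw [hmgf, iteratedDeriv_succ, iteratedDeriv_succ, iteratedDeriv_succ, iteratedDeriv_one,
    h1, h2, h3, h4] at h
  simpa using h.symm

/-- The variance of the square of a centered real Gaussian. -/
lemma variance_sq_gaussianReal_zero (v : ℝ≥0) :
    variance (fun x ↦ x ^ 2) (gaussianReal 0 v) = 2 * (v : ℝ) ^ 2 := by
  have hsq : ∫ x, x ^ 2 ∂(gaussianReal 0 v) = v := by
    have h := variance_fun_id_gaussianReal (μ := 0) (v := v)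
    rwa [variance_of_integral_eq_zero (by fun_prop) (by simp)] at h
  have hL : MemLp (fun x : ℝ ↦ x ^ 2) 2 (gaussianReal 0 v) := by
    rw [memLp_two_iff_integrable_sq (by fun_prop)]
    have h := (memLp_id_gaussianReal (μ := 0) (v := v) 4).integrable_norm_pow (p := 4)
      (by norm_num)
    refine h.congr (.of_forall fun x ↦ ?_)
    have : ‖x‖ ^ 2 = x ^ 2 := by simp
    calc ‖x‖ ^ 4 = (‖x‖ ^ 2) ^ 2 := by ring
      _ = (x ^ 2) ^ 2 := by rw [this]
  rw [variance_eq_sub hL]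
  have h4 : ∫ x, ((fun x : ℝ ↦ x ^ 2) ^ 2) x ∂(gaussianReal 0 v) = 3 * (v : ℝ) ^ 2 := by
    rw [← integral_pow_four_gaussianReal_zero]
    congr 1 with x
    simp only [Pi.pow_apply]
    ring
  rw [h4, hsq]
  ring

/-- The variance of the squared deviation of a real Gaussian from its mean. -/
lemma variance_sub_sq_gaussianReal (μ : ℝ) (v : ℝ≥0) :
    variance (fun x ↦ (x - μ) ^ 2) (gaussianReal μ v) = 2 * (v : ℝ) ^ 2 := by
  have h := variance_map (X := fun x : ℝ ↦ x ^ 2) (Y := fun x ↦ x - μ) (μ := gaussianReal μ v)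
    (by fun_prop) (by fun_prop)
  rw [gaussianReal_map_sub_const, sub_self, variance_sq_gaussianReal_zero] at h
  exact h.symm

/-- for a Gaussian target `f = N(μ,σ²)` density, the tempered distribution is
`N(μ, σ²/β)`; the variance of `log f(X)` is `I(β) = 1/(2β²)`, the quantity
`R(β) = E[(X−μ)²(log f)''(X) − (X−μ)(log f)'(X)]` vanishes, and hence
`(1/2)V(β) − I(β) + R(β)/(4β) = 0` with `V(β) = 1/β²`. -/
theorem gaussian_target_quanta_quantities
    (μ σ β : ℝ) (hσ : 0 < σ) (hβ : 0 < β)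
    (f : ℝ → ℝ)
    (hf : ∀ x, f x = (Real.sqrt (2 * Real.pi * σ ^ 2))⁻¹ *
      Real.exp (-(x - μ) ^ 2 / (2 * σ ^ 2))) :
    variance (fun x => Real.log (f x)) (gaussianReal μ ((σ ^ 2 / β).toNNReal))
        = 1 / (2 * β ^ 2) ∧
    (∫ x, ((x - μ) ^ 2 * deriv (deriv (fun y => Real.log (f y))) x
        - (x - μ) * deriv (fun y => Real.log (f y)) x)
        ∂(gaussianReal μ ((σ ^ 2 / β).toNNReal))) = 0 ∧
    (1 / 2) * (1 / β ^ 2)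
      - variance (fun x => Real.log (f x)) (gaussianReal μ ((σ ^ 2 / β).toNNReal))
      + (∫ x, ((x - μ) ^ 2 * deriv (deriv (fun y => Real.log (f y))) x
          - (x - μ) * deriv (fun y => Real.log (f y)) x)
          ∂(gaussianReal μ ((σ ^ 2 / β).toNNReal))) / (4 * β) = 0 := by
  set c := Real.log (Real.sqrt (2 * Real.pi * σ ^ 2))⁻¹ with hc
  have hlog : (fun x ↦ Real.log (f x)) = fun x ↦ c + -(1 / (2 * σ ^ 2)) * (x - μ) ^ 2 := by
    funext x
    have : (Real.sqrt (2 * Real.pi * σ ^ 2))⁻¹ ≠ 0 := by positivity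
    rw [hf, Real.log_mul this (Real.exp_ne_zero _), Real.log_exp]
    ring
  have hd : deriv (fun x ↦ c + -(1 / (2 * σ ^ 2)) * (x - μ) ^ 2)
      = fun x ↦ -(1 / σ ^ 2) * (x - μ) := by
    funext x
    refine (((((hasDerivAt_id' x).sub_const μ).pow 2).const_mul _).const_add c).deriv.trans ?_
    simp
    field_simp
  have hdd (x : ℝ) : deriv (fun x ↦ -(1 / σ ^ 2) * (x - μ)) x = -(1 / σ ^ 2) :=
    (((hasDerivAt_id' x).sub_const μ).const_mul _).deriv.trans (mul_one _)
  have hR : (∫ x, ((x - μ) ^ 2 * deriv (deriv (fun y ↦ Real.log (f y))) x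
        - (x - μ) * deriv (fun y ↦ Real.log (f y)) x)
        ∂(gaussianReal μ ((σ ^ 2 / β).toNNReal))) = 0 := by
    refine integral_eq_zero_of_ae (.of_forall fun x ↦ ?_)
    simp only [hlog, hd, hdd, Pi.zero_apply]
    ring
  have hV : variance (fun x ↦ Real.log (f x)) (gaussianReal μ ((σ ^ 2 / β).toNNReal))
      = 1 / (2 * β ^ 2) := by
    rw [hlog, variance_const_add (by fun_prop), variance_const_mul, variance_sub_sq_gaussianReal,
      Real.coe_toNNReal _ (by positivity)]
    field_simp
  refine ⟨hV, hR, ?_⟩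
  rw [hV, hR]
  field_simp
  ring
end

section
/- Let f : ℝ → (0,∞) with h := log f four times continuously differentiable, h'(0) = 0, h''(0) < 0, and |h''''(z)| ≤ M for all z ∈ ℝ and some M > 0. Assume f^β is integrable for all β ≥ 1. For β ≥ 1 let g_β be the probability density on ℝ proportional to y ↦ f(y/√(−β h''(0)))^β, with expectation E_{g_β} and variance Var_{g_β}. Assume (a) sup_{β ≥ 1} E_{g_β}[Y^8] < ∞, and (b) there exists γ > 0 with |Var_{g_β}(Y²) − 2| = O(β^{−γ}) as β → ∞. Let I(β) := Var_β[log f] denote the variance of log f under the density f^β/Z_β. Then I(β) − 1/(2β²) = O(β^{−k}) as β → ∞, where k = min(2+γ, 5/2) in general, and k = min(2+γ, 3) if additionally h'''(0) = 0. -/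
open MeasureTheory Filter Asymptotics

/-- Expectation under the rescaled tempered density `g_β ∝ y ↦ f(y/√(−β h''(0)))^β`. -/
noncomputable def Egb (f : ℝ → ℝ) (β : ℝ) (φ : ℝ → ℝ) : ℝ :=
  (∫ y, φ y * f (y / Real.sqrt (-β * deriv (deriv (hlog f)) 0)) ^ β) /
    (∫ y, f (y / Real.sqrt (-β * deriv (deriv (hlog f)) 0)) ^ β)

/-- Variance under the rescaled tempered density `g_β`. -/
noncomputable def Vargb (f : ℝ → ℝ) (β : ℝ) (φ : ℝ → ℝ) : ℝ :=
  Egb f β (fun y => φ y ^ 2) - (Egb f β φ) ^ 2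

open ProbabilityTheory in
lemma integrable_and_abs_integral_le_of_abs_le_one_add_pow_eight {μ : Measure ℝ}
    [IsProbabilityMeasure μ] {s C D : ℝ} (hi : Integrable (fun x : ℝ => (s * x) ^ 8) μ)
    (hC : ∫ x, (s * x) ^ 8 ∂μ ≤ C) (hD : 0 ≤ D) {q : ℝ → ℝ} (hq : AEStronglyMeasurable q μ)
    (hqD : ∀ x, |q x| ≤ D * (1 + (s * x) ^ 8)) :
    Integrable q μ ∧ |∫ x, q x ∂μ| ≤ D * (1 + C) := by
  have h1 : Integrable (fun x : ℝ => D * (1 + (s * x) ^ 8)) μ :=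
    ((integrable_const 1).add hi).const_mul D
  refine ⟨h1.mono' hq (ae_of_all _ hqD), ?_⟩
  calc |∫ x, q x ∂μ| ≤ ∫ x, D * (1 + (s * x) ^ 8) ∂μ :=
        norm_integral_le_of_norm_le (f := q) h1 (ae_of_all _ hqD)
    _ = D * (1 + ∫ x, (s * x) ^ 8 ∂μ) := by
        rw [integral_const_mul, integral_add (integrable_const 1) hi]; simp
    _ ≤ D * (1 + C) := by gcongr

lemma abs_pow_le_inv_pow_mul_one_add_pow_eight {s : ℝ} (hs : 0 < s) (x : ℝ) {k : ℕ}
    (hk : k ≤ 8) : |x| ^ k ≤ s⁻¹ ^ k * (1 + (s * x) ^ 8) := by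
  have h0 : 0 ≤ s * |x| := by positivity
  have h8 : (s * x) ^ 8 = (s * |x|) ^ 8 := by
    rw [mul_pow, mul_pow, Even.pow_abs (by decide)]
  have h1 : (s * |x|) ^ k ≤ 1 + (s * |x|) ^ 8 := by
    rcases le_total (s * |x|) 1 with h | h
    · have := pow_le_one₀ h0 h (n := k)
      have : 0 ≤ (s * |x|) ^ 8 := by positivity
      linarith
    · have := pow_le_pow_right₀ h hk
      linarith
  calc |x| ^ k = s⁻¹ ^ k * (s * |x|) ^ k := by
        rw [← mul_pow, inv_mul_cancel_left₀ hs.ne']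
    _ ≤ _ := by rw [h8]; gcongr

open ProbabilityTheory in
/-- Perturbing `a x²` by a remainder `w` of cubic order changes the variance by
`O(A s⁻⁵ + s⁻⁶)` under a probability measure concentrated at scale `s⁻¹`. -/
lemma abs_variance_sq_add_sub_le {μ : Measure ℝ} [IsProbabilityMeasure μ] {s C A B a : ℝ}
    (hs : 1 ≤ s) (hA : 0 ≤ A) (hB : 0 ≤ B)
    (hi : Integrable (fun x : ℝ => (s * x) ^ 8) μ) (hC : ∫ x, (s * x) ^ 8 ∂μ ≤ C)
    {w : ℝ → ℝ} (hw : AEStronglyMeasurable w μ)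
    (hwb : ∀ x, |w x| ≤ A * |x| ^ 3 + B * |x| ^ 4) :
    MemLp (fun x : ℝ => x ^ 2) 2 μ ∧ MemLp w 2 μ ∧
    |Var[fun x => a * x ^ 2 + w x; μ] - a ^ 2 * Var[fun x => x ^ 2; μ]| ≤
      2 * |a| * (1 + C) * (2 + C) * (A * s⁻¹ ^ 5 + B * s⁻¹ ^ 6) +
        2 * (1 + C) * (A ^ 2 + B ^ 2) * s⁻¹ ^ 6 := by
  have hs0 : 0 < s := by linarith
  have hC0 : 0 ≤ C := le_trans (integral_nonneg fun x => by positivity) hC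
  have hd0 : 0 ≤ s⁻¹ := by positivity
  have hd1 : s⁻¹ ≤ 1 := inv_le_one_of_one_le₀ hs
  have key := fun x (k : ℕ) (hk : k ≤ 8) =>
    abs_pow_le_inv_pow_mul_one_add_pow_eight hs0 x hk
  have hu2 : AEStronglyMeasurable (fun x : ℝ => x ^ 2) μ := by fun_prop
  obtain ⟨-, iu⟩ := integrable_and_abs_integral_le_of_abs_le_one_add_pow_eight hi hC
    (D := s⁻¹ ^ 2) (by positivity) hu2 (fun x => by rw [abs_pow]; exact key x 2 (by norm_num))
  obtain ⟨mu, -⟩ := integrable_and_abs_integral_le_of_abs_le_one_add_pow_eight hi hC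
    (D := s⁻¹ ^ 4) (by positivity) (q := fun x : ℝ => (x ^ 2) ^ 2) (by fun_prop)
    (fun x => by rw [← pow_mul, abs_pow]; exact key x 4 (by norm_num))
  obtain ⟨-, iw⟩ := integrable_and_abs_integral_le_of_abs_le_one_add_pow_eight hi hC
    (D := A * s⁻¹ ^ 3 + B * s⁻¹ ^ 4) (by positivity) hw (fun x => by
      refine (hwb x).trans ?_
      rw [add_mul, mul_assoc, mul_assoc]
      gcongr
      exacts [key x 3 (by norm_num), key x 4 (by norm_num)])
  obtain ⟨-, iuw⟩ := integrable_and_abs_integral_le_of_abs_le_one_add_pow_eight hi hC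
    (D := A * s⁻¹ ^ 5 + B * s⁻¹ ^ 6) (by positivity) (hu2.mul hw) (fun x => by
      simp only [Pi.mul_apply, abs_mul, abs_pow]
      calc |x| ^ 2 * |w x| ≤ |x| ^ 2 * (A * |x| ^ 3 + B * |x| ^ 4) := by gcongr; exact hwb x
        _ = A * |x| ^ 5 + B * |x| ^ 6 := by ring
        _ ≤ _ := by
          rw [add_mul, mul_assoc, mul_assoc]
          gcongr
          exacts [key x 5 (by norm_num), key x 6 (by norm_num)])
  obtain ⟨mw, iww⟩ := integrable_and_abs_integral_le_of_abs_le_one_add_pow_eight hi hC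
    (D := 2 * (A ^ 2 * s⁻¹ ^ 6 + B ^ 2 * s⁻¹ ^ 8)) (by positivity) (hw.pow 2) (fun x => by
      simp only [Pi.pow_apply, abs_pow]
      calc |w x| ^ 2 ≤ (A * |x| ^ 3 + B * |x| ^ 4) ^ 2 := by gcongr; exact hwb x
        _ ≤ 2 * (A ^ 2 * |x| ^ 6 + B ^ 2 * |x| ^ 8) := by
          nlinarith [sq_nonneg (A * |x| ^ 3 - B * |x| ^ 4)]
        _ ≤ _ := by
          rw [mul_assoc, add_mul, mul_assoc, mul_assoc]
          gcongr
          exacts [key x 6 (by norm_num), key x 8 (by norm_num)])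
  have lu : MemLp (fun x : ℝ => x ^ 2) 2 μ := (memLp_two_iff_integrable_sq hu2).2 mu
  have lw : MemLp w 2 μ := (memLp_two_iff_integrable_sq hw).2 mw
  refine ⟨lu, lw, ?_⟩
  have hVw : Var[w; μ] ≤ ∫ x, (w ^ 2) x ∂μ := by
    simpa using variance_le_expectation_sq hw
  have hVw' : 0 ≤ Var[w; μ] := variance_nonneg _ _
  have hcov : |cov[fun x => x ^ 2, w; μ]| ≤
      (1 + C) * (2 + C) * (A * s⁻¹ ^ 5 + B * s⁻¹ ^ 6) := by
    rw [covariance_eq_sub lu lw]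
    refine (abs_sub _ _).trans ?_
    rw [abs_mul]
    calc _ ≤ (A * s⁻¹ ^ 5 + B * s⁻¹ ^ 6) * (1 + C) +
          (s⁻¹ ^ 2 * (1 + C)) * ((A * s⁻¹ ^ 3 + B * s⁻¹ ^ 4) * (1 + C)) := by gcongr
      _ = _ := by ring
  rw [variance_fun_add (lu.const_mul a) lw, variance_const_mul, covariance_const_mul_left]
  have hww : Var[w; μ] ≤ 2 * (1 + C) * (A ^ 2 + B ^ 2) * s⁻¹ ^ 6 := by
    have h8 : s⁻¹ ^ 8 ≤ s⁻¹ ^ 6 := pow_le_pow_of_le_one hd0 hd1 (by norm_num)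
    calc _ ≤ 2 * (A ^ 2 * s⁻¹ ^ 6 + B ^ 2 * s⁻¹ ^ 8) * (1 + C) :=
          hVw.trans ((le_abs_self _).trans iww)
      _ ≤ 2 * (A ^ 2 * s⁻¹ ^ 6 + B ^ 2 * s⁻¹ ^ 6) * (1 + C) := by gcongr
      _ = _ := by ring
  calc _ = |2 * a * cov[fun x => x ^ 2, w; μ] + Var[w; μ]| := by congr 1; ring
    _ ≤ 2 * |a| * |cov[fun x => x ^ 2, w; μ]| + Var[w; μ] := by
      refine (abs_add_le _ _).trans ?_
      rw [abs_mul, abs_mul, abs_of_nonneg hVw', abs_two]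
    _ ≤ 2 * |a| * ((1 + C) * (2 + C) * (A * s⁻¹ ^ 5 + B * s⁻¹ ^ 6)) +
        2 * (1 + C) * (A ^ 2 + B ^ 2) * s⁻¹ ^ 6 := by gcongr
    _ = _ := by ring

lemma abs_le_of_abs_deriv_le {g : ℝ → ℝ} (hg : Differentiable ℝ g) (hg0 : g 0 = 0) {A B : ℝ}
    (hA : 0 ≤ A) (hB : 0 ≤ B) {n : ℕ}
    (h : ∀ x, |deriv g x| ≤ A * |x| ^ n + B * |x| ^ (n + 1)) (x : ℝ) :
    |g x| ≤ A * |x| ^ (n + 1) + B * |x| ^ (n + 2) := by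
  have := Convex.norm_image_sub_le_of_norm_deriv_le (f := g) (s := Metric.closedBall 0 |x|)
    (x := 0) (y := x) (C := A * |x| ^ n + B * |x| ^ (n + 1)) (fun y _ => hg y)
    (fun y hy => by
      have hy : |y| ≤ |x| := by simpa using hy
      refine (h y).trans ?_
      gcongr) (convex_closedBall _ _) (by simp) (by simp)
  simp only [hg0, sub_zero, Real.norm_eq_abs] at this
  calc _ ≤ _ := this
    _ = _ := by ring

/-- A bounded fourth derivative gives Taylor bounds at a critical point for `h` and `h'`. -/
lemma taylor_bounds_of_fourth_deriv_bounded {h : ℝ → ℝ} (hs : ContDiff ℝ 4 h)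
    (h0 : deriv h 0 = 0) {M : ℝ} (hM : 0 ≤ M)
    (hb : ∀ z, |deriv (deriv (deriv (deriv h))) z| ≤ M) :
    (∀ x, |deriv h x - deriv (deriv h) 0 * x| ≤
      |deriv (deriv (deriv h)) 0| * |x| ^ 2 + M * |x| ^ 3) ∧
    ∀ x, |h x - h 0 - deriv (deriv h) 0 / 2 * x ^ 2| ≤
      |deriv (deriv (deriv h)) 0| * |x| ^ 3 + M * |x| ^ 4 := by
  have c1 : ContDiff ℝ 3 (deriv h) := ((contDiff_succ_iff_deriv (n := 3)).1 hs).2.2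
  have c2 : ContDiff ℝ 2 (deriv (deriv h)) := ((contDiff_succ_iff_deriv (n := 2)).1 c1).2.2
  have c3 : ContDiff ℝ 1 (deriv (deriv (deriv h))) :=
    ((contDiff_succ_iff_deriv (n := 1)).1 c2).2.2
  have d0 : Differentiable ℝ h := hs.differentiable (by norm_num)
  have d1 : Differentiable ℝ (deriv h) := c1.differentiable (by norm_num)
  have d2 : Differentiable ℝ (deriv (deriv h)) := c2.differentiable (by norm_num)
  have d3 : Differentiable ℝ (deriv (deriv (deriv h))) := c3.differentiable (by norm_num)
  set A := |deriv (deriv (deriv h)) 0|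
  have hA : 0 ≤ A := abs_nonneg _
  have b3 : ∀ x, |deriv (deriv (deriv h)) x| ≤ A * |x| ^ 0 + M * |x| ^ (0 + 1) := by
    intro x
    have := Convex.norm_image_sub_le_of_norm_deriv_le (f := deriv (deriv (deriv h)))
      (s := Set.univ) (x := 0) (y := x) (fun y _ => d3 y) (fun y _ => hb y) convex_univ
      trivial trivial
    simp only [Real.norm_eq_abs, sub_zero] at this
    have h2 := abs_sub_abs_le_abs_sub (deriv (deriv (deriv h)) x) (deriv (deriv (deriv h)) 0)
    simp only [pow_zero, zero_add, pow_one, mul_one]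
    linarith
  have b2 := abs_le_of_abs_deriv_le (g := fun x => deriv (deriv h) x - deriv (deriv h) 0)
    (d2.sub_const _) (sub_self _) hA hM (n := 0) (fun x => by
      rw [deriv_sub_const]; exact b3 x)
  have b1 := abs_le_of_abs_deriv_le (g := fun x => deriv h x - deriv (deriv h) 0 * x)
    (by fun_prop) (by simp [h0]) hA hM (n := 1) (fun x => by
      rw [deriv_fun_sub (d1 x) (by fun_prop), deriv_const_mul_id']; exact b2 x)
  refine ⟨b1, abs_le_of_abs_deriv_le (g := fun x => h x - h 0 - deriv (deriv h) 0 / 2 * x ^ 2)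
    (by fun_prop) (by simp) hA hM (n := 2) (fun x => ?_)⟩
  rw [deriv_fun_sub (by fun_prop) (by fun_prop), deriv_sub_const, deriv_const_mul_field,
    deriv_pow_field]
  have := b1 x
  convert this using 3
  push_cast
  ring

/-- If `|h'|` grows at most cubically and `x⁴ e^{bh}` is integrable, then `e^{bh}` decays at
least like `1/|x|`. -/
lemma exists_abs_mul_exp_le_of_integrable {h : ℝ → ℝ} (hd : Differentiable ℝ h) {K b : ℝ}
    (hK : 0 ≤ K) (hh : ∀ x, 1 ≤ |x| → |deriv h x| ≤ K * |x| ^ 3) (hb : 0 ≤ b)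
    (hi : Integrable fun x => x ^ 4 * Real.exp (b * h x)) :
    ∃ D, ∀ x, 1 ≤ |x| → |x| * Real.exp (b * h x) ≤ D := by
  refine ⟨Real.exp (b * (8 * K)) * ∫ x, x ^ 4 * Real.exp (b * h x), fun a ha => ?_⟩
  have ha0 : 0 < |a| := by linarith
  obtain ⟨S, hS⟩ : ∃ S, S = Set.uIcc a (a + (a ^ 3)⁻¹) := ⟨_, rfl⟩
  have hinv : |(a ^ 3)⁻¹| = (|a| ^ 3)⁻¹ := by rw [abs_inv, abs_pow]
  have hSa : ∀ x ∈ S, |a| ≤ |x| ∧ |x - a| ≤ (|a| ^ 3)⁻¹ := by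
    intro x hx
    rcases le_total 0 a with h0 | h0
    · have : 0 ≤ (a ^ 3)⁻¹ := by positivity
      rw [hS, Set.uIcc_of_le (by linarith)] at hx
      obtain ⟨h1, h2⟩ := hx
      rw [abs_of_nonneg h0, abs_of_nonneg (h0.trans h1), abs_of_nonneg (by linarith)]
      exact ⟨h1, by linarith⟩
    · have : (a ^ 3)⁻¹ ≤ 0 := inv_nonpos.2 (Odd.pow_nonpos (by decide) h0)
      rw [hS, Set.uIcc_of_ge (by linarith)] at hx
      obtain ⟨h1, h2⟩ := hx
      rw [← hinv, abs_of_nonpos h0, abs_of_nonpos (h2.trans h0), abs_of_nonpos (by linarith),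
        abs_of_nonpos this]
      exact ⟨by linarith, by linarith⟩
  have hlow : ∀ x ∈ S, |a| ^ 4 * (Real.exp (-(b * (8 * K))) * Real.exp (b * h a)) ≤
      x ^ 4 * Real.exp (b * h x) := by
    intro x hx
    have h1 := Convex.norm_image_sub_le_of_norm_deriv_le (f := h) (s := S)
      (x := a) (y := x) (C := K * (2 * |a|) ^ 3) (fun y _ => hd y)
      (fun y hy => by
        obtain ⟨h1, h2⟩ := hSa y hy
        refine (hh y (ha.trans h1)).trans ?_
        have h3 : (|a| ^ 3)⁻¹ ≤ 1 := inv_le_one_of_one_le₀ (one_le_pow₀ ha)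
        have h4 := abs_sub_abs_le_abs_sub y a
        gcongr
        linarith) (hS ▸ convex_uIcc _ _) (hS ▸ Set.left_mem_uIcc) hx
    have h2 : |h x - h a| ≤ 8 * K := by
      calc |h x - h a| ≤ K * (2 * |a|) ^ 3 * |x - a| := h1
        _ ≤ K * (2 * |a|) ^ 3 * (|a| ^ 3)⁻¹ := by gcongr; exact (hSa x hx).2
        _ = 8 * K := by field_simp; norm_num
    rw [← Real.exp_add]
    have h4 : |a| ^ 4 ≤ x ^ 4 := by
      rw [← Even.pow_abs (by decide : Even 4) x]
      exact pow_le_pow_left₀ ha0.le (hSa x hx).1 4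
    have h5 : -(8 * K) + h a ≤ h x := by linarith [(abs_le.1 h2).1]
    have h6 : -(b * (8 * K)) + b * h a ≤ b * h x := by nlinarith
    gcongr
  have hvol : volume.real S = (|a| ^ 3)⁻¹ := by
    simp [hS, Measure.real]
  have hle := (setIntegral_ge_of_const_le_real (μ := volume) (hS ▸ measurableSet_uIcc)
    (hS ▸ isCompact_uIcc.measure_lt_top.ne) hlow hi.integrableOn).trans
    (setIntegral_le_integral hi (ae_of_all _ fun x => by positivity))
  rw [hvol] at hle
  calc |a| * Real.exp (b * h a) = Real.exp (b * (8 * K)) *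
        (|a| ^ 4 * (Real.exp (-(b * (8 * K))) * Real.exp (b * h a)) * (|a| ^ 3)⁻¹) := by
        rw [Real.exp_neg]; field_simp
    _ ≤ _ := by gcongr

lemma integrable_pow_eight_mul_exp {h : ℝ → ℝ} (hc : Continuous h) {b D β : ℝ}
    (hdec : ∀ x, 1 ≤ |x| → |x| * Real.exp (b * h x) ≤ D)
    (hi : Integrable fun x => Real.exp (β * h x))
    (hi' : Integrable fun x => Real.exp ((β - 8 * b) * h x)) :
    Integrable fun x => x ^ 8 * Real.exp (β * h x) := by
  refine (hi.add (hi'.const_mul (D ^ 8))).mono' (by fun_prop) (ae_of_all _ fun x => ?_)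
  have hx8 : x ^ 8 = |x| ^ 8 := (Even.pow_abs (by decide) x).symm
  rw [Real.norm_of_nonneg (by positivity), hx8]
  simp only [Pi.add_apply]
  rcases le_total |x| 1 with h1 | h1
  · have : |x| ^ 8 ≤ 1 := pow_le_one₀ (abs_nonneg _) h1
    have h2 : 0 ≤ D ^ 8 * Real.exp ((β - 8 * b) * h x) := by positivity
    nlinarith [Real.exp_pos (β * h x)]
  · have e : |x| ^ 8 * Real.exp (β * h x) =
        (|x| * Real.exp (b * h x)) ^ 8 * Real.exp ((β - 8 * b) * h x) := by
      rw [mul_pow, ← Real.exp_nat_mul, mul_assoc, ← Real.exp_add]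
      congr 2
      push_cast
      ring
    rw [e]
    have : (|x| * Real.exp (b * h x)) ^ 8 ≤ D ^ 8 := by
      gcongr
      exact hdec x h1
    nlinarith [Real.exp_pos (β * h x), Real.exp_pos ((β - 8 * b) * h x)]

lemma rpow_eq_exp_mul_hlog {f : ℝ → ℝ} (hf : ∀ x, 0 < f x) (β x : ℝ) :
    f x ^ β = Real.exp (β * hlog f x) := by
  rw [Real.rpow_def_of_pos (hf x), mul_comm]; rfl

lemma Eb_eq_integral_tilted {f : ℝ → ℝ} (hf : ∀ x, 0 < f x) (β : ℝ) (φ : ℝ → ℝ) :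
    Eb f β φ = ∫ x, φ x ∂(volume.tilted fun x => β * hlog f x) := by
  simp only [Eb, rpow_eq_exp_mul_hlog hf, integral_tilted, smul_eq_mul]
  rw [← integral_div]
  congr 1 with x
  ring

lemma Egb_eq_Eb {f : ℝ → ℝ} {β : ℝ}
    (hs : 0 < Real.sqrt (-β * deriv (deriv (hlog f)) 0)) (φ : ℝ → ℝ) :
    Egb f β φ = Eb f β fun x => φ (Real.sqrt (-β * deriv (deriv (hlog f)) 0) * x) := by
  unfold Egb Eb
  set s := Real.sqrt (-β * deriv (deriv (hlog f)) 0)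
  have h1 := Measure.integral_comp_div (fun x => φ (s * x) * f x ^ β) s
  have h2 := Measure.integral_comp_div (fun x => f x ^ β) s
  simp only [mul_div_cancel₀ _ hs.ne', smul_eq_mul] at h1 h2
  rw [h1, h2, mul_div_mul_left _ _ (abs_pos.2 hs.ne').ne']

open ProbabilityTheory in
lemma Varb_eq_variance {f : ℝ → ℝ} (hf : ∀ x, 0 < f x) {β : ℝ}
    [IsProbabilityMeasure (volume.tilted fun x => β * hlog f x)] {φ : ℝ → ℝ}
    (hφ : MemLp φ 2 (volume.tilted fun x => β * hlog f x)) :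
    Varb f β φ = Var[φ; volume.tilted fun x => β * hlog f x] := by
  rw [variance_eq_sub hφ, Varb, Eb_eq_integral_tilted hf, Eb_eq_integral_tilted hf]
  rfl

lemma Vargb_sq_eq {f : ℝ → ℝ} {β : ℝ}
    (hs : 0 < Real.sqrt (-β * deriv (deriv (hlog f)) 0)) :
    Vargb f β (fun y => y ^ 2) =
      Real.sqrt (-β * deriv (deriv (hlog f)) 0) ^ 4 * Varb f β fun x => x ^ 2 := by
  rw [Vargb, Egb_eq_Eb hs, Egb_eq_Eb hs, Varb]
  set s := Real.sqrt (-β * deriv (deriv (hlog f)) 0)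
  have h (c : ℝ) (φ : ℝ → ℝ) : Eb f β (fun x => c * φ x) = c * Eb f β φ := by
    simp only [Eb, mul_assoc, integral_const_mul, mul_div_assoc]
  simp only [mul_pow]
  rw [h, h]
  ring

/-- If the rescaled variance of `y²` is close to `2`, then the fourth moment is not a junk value. -/
lemma exists_integrable_pow_four {f : ℝ → ℝ} (hf : ∀ x, 0 < f x)
    (hcurv : deriv (deriv (hlog f)) 0 < 0) {γ : ℝ} (hγ : 0 < γ)
    (hvar : (fun β => Vargb f β (fun y => y ^ 2) - 2) =O[atTop] fun β : ℝ => β ^ (-γ)) :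
    ∃ b : ℝ, 1 ≤ b ∧ Integrable fun x => x ^ 4 * Real.exp (b * hlog f x) := by
  have ht := hvar.trans_tendsto (tendsto_rpow_neg_atTop hγ)
  obtain ⟨b, h1, h2⟩ :=
    ((ht.eventually (lt_mem_nhds (by norm_num : (-1 : ℝ) < 0))).and (eventually_ge_atTop 1)).exists
  refine ⟨b, h2, ?_⟩
  by_contra hn
  have hs : 0 < Real.sqrt (-b * deriv (deriv (hlog f)) 0) := Real.sqrt_pos.2 (by nlinarith)
  have hE : Eb f b (fun x => (x ^ 2) ^ 2) = 0 := by
    simp only [Eb, rpow_eq_exp_mul_hlog hf, ← pow_mul]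
    rw [integral_undef hn, zero_div]
  have hle : Varb f b (fun x => x ^ 2) ≤ 0 := by
    rw [Varb, hE]
    nlinarith [sq_nonneg (Eb f b fun x => x ^ 2)]
  have hle' := mul_nonpos_of_nonneg_of_nonpos (pow_nonneg hs.le 4) hle
  rw [← Vargb_sq_eq hs] at hle'
  linarith

/-- The eighth moment of the tempered density is finite at low temperature. -/
lemma integrable_pow_eight_mul_exp_hlog {f : ℝ → ℝ}
    (hsmooth : ContDiff ℝ 4 (hlog f)) (hmode : deriv (hlog f) 0 = 0) {M : ℝ} (hM : 0 ≤ M)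
    (hbound : ∀ z, |deriv (deriv (deriv (deriv (hlog f)))) z| ≤ M)
    (hint : ∀ β : ℝ, 1 ≤ β → Integrable fun x => Real.exp (β * hlog f x))
    {b : ℝ} (hb : 1 ≤ b) (hi : Integrable fun x => x ^ 4 * Real.exp (b * hlog f x)) :
    ∀ β, 8 * b + 1 ≤ β → Integrable fun x => x ^ 8 * Real.exp (β * hlog f x) := by
  obtain ⟨D, hD⟩ := exists_abs_mul_exp_le_of_integrable (h := hlog f)
    (K := |deriv (deriv (hlog f)) 0| + |deriv (deriv (deriv (hlog f))) 0| + M)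
    (hsmooth.differentiable (by norm_num)) (by positivity) (fun x hx => by
      have h1 := (taylor_bounds_of_fourth_deriv_bounded hsmooth hmode hM hbound).1 x
      have h2 := abs_sub_abs_le_abs_sub (deriv (hlog f) x) (deriv (deriv (hlog f)) 0 * x)
      rw [abs_mul] at h2
      have h3 : |x| ≤ |x| ^ 3 := le_self_pow₀ hx (by norm_num)
      have h4 : |x| ^ 2 ≤ |x| ^ 3 := pow_le_pow_right₀ hx (by norm_num)
      have h5 := mul_le_mul_of_nonneg_left h3 (abs_nonneg (deriv (deriv (hlog f)) 0))
      have h6 := mul_le_mul_of_nonneg_left h4 (abs_nonneg (deriv (deriv (deriv (hlog f))) 0))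
      linarith) (by linarith) hi
  exact fun β hβ => integrable_pow_eight_mul_exp hsmooth.continuous hD
    (hint β (by linarith)) (hint _ (by linarith))

open ProbabilityTheory in
lemma abs_Varb_hlog_sub_le {f : ℝ → ℝ} (hf : ∀ x, 0 < f x)
    (hsmooth : ContDiff ℝ 4 (hlog f)) (hmode : deriv (hlog f) 0 = 0) {M : ℝ} (hM : 0 ≤ M)
    (hbound : ∀ z, |deriv (deriv (deriv (deriv (hlog f)))) z| ≤ M) {β s A C : ℝ}
    (hsdef : s = Real.sqrt (-β * deriv (deriv (hlog f)) 0)) (hs : 1 ≤ s)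
    (hA : A = |deriv (deriv (deriv (hlog f))) 0|)
    (hint : Integrable fun x => Real.exp (β * hlog f x))
    (hint8 : Integrable fun x => x ^ 8 * Real.exp (β * hlog f x))
    (hC : Egb f β (fun y => y ^ 8) ≤ C) :
    |Varb f β (hlog f) - Vargb f β (fun y => y ^ 2) / (4 * β ^ 2)| ≤
      2 * |deriv (deriv (hlog f)) 0 / 2| * (1 + C) * (2 + C) *
        (A * s⁻¹ ^ 5 + M * s⁻¹ ^ 6) + 2 * (1 + C) * (A ^ 2 + M ^ 2) * s⁻¹ ^ 6 := by
  have hs0 : 0 < Real.sqrt (-β * deriv (deriv (hlog f)) 0) := by rw [← hsdef]; linarith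
  have hs2 : s ^ 2 = -β * deriv (deriv (hlog f)) 0 := by
    rw [hsdef, Real.sq_sqrt (Real.sqrt_pos.1 hs0).le]
  rw [Vargb_sq_eq hs0, ← hsdef]
  rw [Egb_eq_Eb hs0, ← hsdef, Eb_eq_integral_tilted hf] at hC
  have hprob : IsProbabilityMeasure (volume.tilted fun x => β * hlog f x) :=
    isProbabilityMeasure_tilted hint
  obtain ⟨hu, hw, hmain⟩ := abs_variance_sq_add_sub_le
    (μ := volume.tilted fun x => β * hlog f x) (a := deriv (deriv (hlog f)) 0 / 2)
    (w := fun x => hlog f x - hlog f 0 - deriv (deriv (hlog f)) 0 / 2 * x ^ 2)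
    (A := A) hs (hA ▸ abs_nonneg _) hM
    ((integrable_tilted_iff hint _).2 (by
      refine (hint8.const_mul (s ^ 8)).congr (ae_of_all _ fun x => ?_)
      simp only [smul_eq_mul]
      ring)) hC
    (by have := hsmooth.continuous; fun_prop)
    (hA ▸ (taylor_bounds_of_fourth_deriv_bounded hsmooth hmode hM hbound).2)
  have hL : MemLp (hlog f) 2 (volume.tilted fun x => β * hlog f x) := by
    refine (((hu.const_mul (deriv (deriv (hlog f)) 0 / 2)).add hw).add
      (memLp_const (hlog f 0))).ae_eq (ae_of_all _ fun x => ?_)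
    simp
  have hV : Var[hlog f; volume.tilted fun x => β * hlog f x] =
      Var[fun x => deriv (deriv (hlog f)) 0 / 2 * x ^ 2 +
        (hlog f x - hlog f 0 - deriv (deriv (hlog f)) 0 / 2 * x ^ 2);
        volume.tilted fun x => β * hlog f x] := by
    rw [← variance_add_const hL.1 (-hlog f 0)]
    congr 1 with x
    ring
  have hβ : β ≠ 0 := by
    rintro rfl
    simp at hs0
  rw [Varb_eq_variance hf hL, Varb_eq_variance hf hu, hV]
  convert hmain using 3
  rw [show s ^ 4 = (s ^ 2) ^ 2 by ring, hs2]
  field_simp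
  norm_num

lemma exists_abs_Varb_hlog_sub_le_rpow {f : ℝ → ℝ} (hf : ∀ x, 0 < f x)
    (hsmooth : ContDiff ℝ 4 (hlog f)) (hmode : deriv (hlog f) 0 = 0)
    (hcurv : deriv (deriv (hlog f)) 0 < 0) {M : ℝ} (hM : 0 ≤ M)
    (hbound : ∀ z, |deriv (deriv (deriv (deriv (hlog f)))) z| ≤ M)
    (hint : ∀ β : ℝ, 1 ≤ β → Integrable fun x => Real.exp (β * hlog f x)) {C : ℝ}
    (hmom8 : ∀ β : ℝ, 1 ≤ β → Egb f β (fun y => y ^ 8) ≤ C) {γ : ℝ} (hγ : 0 < γ)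
    (hvar : (fun β => Vargb f β (fun y => y ^ 2) - 2) =O[atTop] fun β : ℝ => β ^ (-γ)) :
    ∃ K L : ℝ, ∀ᶠ β in atTop,
      |Varb f β (hlog f) - Vargb f β (fun y => y ^ 2) / (4 * β ^ 2)| ≤
        K * |deriv (deriv (deriv (hlog f))) 0| * β ^ (-(5 / 2) : ℝ) + L * β ^ (-3 : ℝ) := by
  obtain ⟨b, hb, hi⟩ := exists_integrable_pow_four hf hcurv hγ hvar
  have h8 := integrable_pow_eight_mul_exp_hlog hsmooth hmode hM hbound hint hb hi
  obtain ⟨A, hA⟩ : ∃ A, A = |deriv (deriv (deriv (hlog f))) 0| := ⟨_, rfl⟩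
  obtain ⟨r, hr⟩ : ∃ r, r = (Real.sqrt (-deriv (deriv (hlog f)) 0))⁻¹ := ⟨_, rfl⟩
  obtain ⟨P, hP⟩ : ∃ P, P = 2 * |deriv (deriv (hlog f)) 0 / 2| * (1 + C) * (2 + C) := ⟨_, rfl⟩
  refine ⟨P * r ^ 5, (P * M + 2 * (1 + C) * (A ^ 2 + M ^ 2)) * r ^ 6, ?_⟩
  filter_upwards [eventually_ge_atTop (8 * b + 1),
    eventually_ge_atTop ((-deriv (deriv (hlog f)) 0)⁻¹)] with β h1 h2
  have hβ : 0 < β := by linarith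
  have hs : 1 ≤ Real.sqrt (-β * deriv (deriv (hlog f)) 0) := by
    rw [Real.one_le_sqrt, neg_mul, ← mul_neg]
    exact (inv_le_iff_one_le_mul₀ (by linarith)).1 h2
  have hinv : (Real.sqrt (-β * deriv (deriv (hlog f)) 0))⁻¹ = r * β ^ (-(1 / 2) : ℝ) := by
    rw [hr, neg_mul, ← mul_neg, Real.sqrt_mul hβ.le, mul_inv, mul_comm, Real.rpow_neg hβ.le,
      Real.sqrt_eq_rpow β]
  have hmain := abs_Varb_hlog_sub_le hf hsmooth hmode hM hbound rfl hs hA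
    (hint β (by linarith)) (h8 β h1) (hmom8 β (by linarith))
  have e5 : (β ^ (-(1 / 2) : ℝ)) ^ 5 = β ^ (-(5 / 2) : ℝ) := by
    rw [← Real.rpow_mul_natCast hβ.le]; norm_num
  have e6 : (β ^ (-(1 / 2) : ℝ)) ^ 6 = β ^ (-3 : ℝ) := by
    rw [← Real.rpow_mul_natCast hβ.le]; norm_num
  rw [hinv, mul_pow, mul_pow, e5, e6, ← hP] at hmain
  rw [← hA]
  refine hmain.trans_eq ?_
  ring

lemma isBigO_rpow_neg_of_le {p q : ℝ} (h : q ≤ p) :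
    (fun β : ℝ => β ^ (-p)) =O[atTop] fun β : ℝ => β ^ (-q) :=
  IsBigO.of_bound 1 (by
    filter_upwards [eventually_ge_atTop 1] with β hβ
    rw [one_mul, Real.norm_of_nonneg (by positivity), Real.norm_of_nonneg (by positivity)]
    exact Real.rpow_le_rpow_of_exponent_le hβ (by linarith))

/-- cold-temperature expansion of `I(β) = Var_β[log f]`:
`I(β) − 1/(2β²) = O(β^{−k})` with `k = min(2+γ, 5/2)` in general and
`k = min(2+γ, 3)` when `h'''(0) = 0`. -/
theorem cold_temperature_I_expansion
    (f : ℝ → ℝ) (hf_pos : ∀ x, 0 < f x)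
    (hsmooth : ContDiff ℝ 4 (hlog f))
    (hmode : deriv (hlog f) 0 = 0)
    (hcurv : deriv (deriv (hlog f)) 0 < 0)
    (M : ℝ) (hM : 0 < M)
    (hbound : ∀ z, |deriv (deriv (deriv (deriv (hlog f)))) z| ≤ M)
    (hint : ∀ β : ℝ, 1 ≤ β → Integrable (fun x => f x ^ β))
    (C : ℝ) (hmom8 : ∀ β : ℝ, 1 ≤ β → Egb f β (fun y => y ^ 8) ≤ C)
    (γ : ℝ) (hγ : 0 < γ)
    (hvar : (fun β => Vargb f β (fun y => y ^ 2) - 2) =O[atTop] fun β : ℝ => β ^ (-γ)) :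
    ((fun β => Varb f β (hlog f) - 1 / (2 * β ^ 2)) =O[atTop]
        fun β : ℝ => β ^ (-(min (2 + γ) (5 / 2)))) ∧
      (deriv (deriv (deriv (hlog f))) 0 = 0 →
        (fun β => Varb f β (hlog f) - 1 / (2 * β ^ 2)) =O[atTop]
          fun β : ℝ => β ^ (-(min (2 + γ) 3))) := by
  have hint' (β : ℝ) (hβ : 1 ≤ β) : Integrable fun x => Real.exp (β * hlog f x) := by
    simpa only [rpow_eq_exp_mul_hlog hf_pos] using hint β hβ
  obtain ⟨K, L, hKL⟩ := exists_abs_Varb_hlog_sub_le_rpow hf_pos hsmooth hmode hcurv hM.le hbound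
    hint' hmom8 hγ hvar
  have hlead : (fun β => Vargb f β (fun y => y ^ 2) / (4 * β ^ 2) - 1 / (2 * β ^ 2))
      =O[atTop] fun β : ℝ => β ^ (-(2 + γ)) := by
    have h2 : (fun β : ℝ => 1 / 4 * β ^ (-2 : ℝ)) =O[atTop] fun β : ℝ => β ^ (-2 : ℝ) :=
      (isBigO_refl _ _).const_mul_left _
    refine (hvar.mul h2).congr' ?_ ?_
    · filter_upwards [eventually_gt_atTop 0] with β hβ
      rw [Real.rpow_neg hβ.le, Real.rpow_two]
      field_simp
      ring
    · filter_upwards [eventually_gt_atTop 0] with β hβ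
      rw [← Real.rpow_add hβ]
      congr 1
      ring
  have hrem : ∀ p : ℝ, ((fun β : ℝ => K * |deriv (deriv (deriv (hlog f))) 0| *
      β ^ (-(5 / 2) : ℝ) + L * β ^ (-3 : ℝ)) =O[atTop] fun β : ℝ => β ^ (-p)) →
      (fun β => Varb f β (hlog f) - 1 / (2 * β ^ 2)) =O[atTop]
        fun β : ℝ => β ^ (-(min (2 + γ) p)) := by
    intro p hp
    have h1 : (fun β => Varb f β (hlog f) - Vargb f β (fun y => y ^ 2) / (4 * β ^ 2))
        =O[atTop] fun β : ℝ => β ^ (-p) :=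
      (IsBigO.of_bound 1 (by
        filter_upwards [hKL] with β hβ
        rw [one_mul]
        exact hβ.trans (le_abs_self _))).trans hp
    refine ((h1.trans (isBigO_rpow_neg_of_le (min_le_right _ _))).add
      (hlead.trans (isBigO_rpow_neg_of_le (min_le_left _ _)))).congr_left fun β => ?_
    ring
  refine ⟨hrem _ ?_, fun h3 => hrem _ ?_⟩
  · exact ((isBigO_refl _ _).const_mul_left _).add
      ((isBigO_rpow_neg_of_le (by norm_num)).const_mul_left _)
  · simp only [h3, abs_zero, mul_zero, zero_mul, zero_add]
    exact (isBigO_refl _ _).const_mul_left _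
end
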